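/- arXiv:2104.00710 — 8 statements merged into one kernel-verified Lean document; each statement's English description precedes it below -/
import Mathlib

section
/- Let L ≥ 1 and let λ = (λ_1 ≥ λ_2 ≥ ⋯ ≥ λ_L ≥ 0) be a partition with at most L parts. Then in the polynomial ring ℤ[q,t] one has the identity ∏_{1≤i<j≤L} (qt^{j−i}; q)_{λ_i−λ_j} · ∏_{i=1}^{L} (qt^{L−i+1}; q)_{λ_i} = h_{q,t}(qt; λ) · ∏_{1≤i<j≤L} (qt^{j−i+1}; q)_{λ_i−λ_j}. Equivalently, as rational functions in q and t, ∏_{1≤i<j≤L} (qt^{j−i};q)_{λ_i−λ_j}/(qt^{j−i+1};q)_{λ_i−λ_j} = h_{q,t}(qt;λ) · ∏_{i=1}^{L} (qt^{L−i+1};q)_{λ_i}^{−1}. -/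
/-- The q-Pochhammer symbol `(a;q)_n = ∏_{l=0}^{n−1} (1 − a q^l)`. -/
def qPoch {R : Type*} [CommRing R] (a q : R) (n : ℕ) : R :=
  ∏ l ∈ Finset.range n, (1 - a * q ^ l)

/-- The leg of the box `(i,j)` in the Ferrers diagram of a partition with at
most `L` parts: `leg(i,j;λ) = #{l : i < l ≤ L, j ≤ λ_l}`. -/
def leg (L : ℕ) (lam : ℕ → ℕ) (i j : ℕ) : ℕ :=
  ((Finset.Icc (i + 1) L).filter fun l => j ≤ lam l).card

/-- The (q,t)-hook product
`h_{q,t}(a;λ) = ∏_{(i,j)∈λ} (1 − a q^{arm(i,j;λ)} t^{leg(i,j;λ)})`,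
where `arm(i,j;λ) = λ_i − j`. -/
def hookProd {R : Type*} [CommRing R] (L : ℕ) (lam : ℕ → ℕ) (a q t : R) : R :=
  ∏ i ∈ Finset.Icc 1 L, ∏ j ∈ Finset.Icc 1 (lam i),
    (1 - a * q ^ (lam i - j) * t ^ leg L lam i j)

theorem qPoch_sub_eq_prod_Ioc {R : Type*} [CommRing R] (a q : R) (m N : ℕ) :
    qPoch a q (N - m) = ∏ j ∈ Finset.Ioc m N, (1 - a * q ^ (N - j)) := by
  unfold qPoch
  refine Finset.prod_bij' (fun l _ => N - l) (fun j _ => N - j) ?_ ?_ ?_ ?_ ?_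
  · intro l hl
    simp only [Finset.mem_range, Finset.mem_Ioc] at *
    omega
  · intro j hj
    simp only [Finset.mem_range, Finset.mem_Ioc] at *
    omega
  · intro l hl
    simp only [Finset.mem_range] at *
    omega
  · intro j hj
    simp only [Finset.mem_Ioc] at *
    omega
  · intro l hl
    simp only [Finset.mem_range] at hl
    rw [show N - (N - l) = l by omega]

theorem leg_self (i : ℕ) (lam : ℕ → ℕ) (j : ℕ) : leg i lam i j = 0 := by
  simp [leg]

theorem leg_succ_of_lt {L i j : ℕ} {lam : ℕ → ℕ} (h : lam (L + 1) < j) :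
    leg (L + 1) lam i j = leg L lam i j := by
  unfold leg
  congr 1
  ext l
  simp only [Finset.mem_filter, Finset.mem_Icc]
  constructor
  · rintro ⟨⟨h1, h2⟩, h3⟩
    have : l ≠ L + 1 := by
      rintro rfl
      omega
    omega
  · rintro ⟨⟨h1, h2⟩, h3⟩
    omega

theorem leg_eq_sub {L i j : ℕ} {lam : ℕ → ℕ} (h : ∀ l, i < l → l ≤ L → j ≤ lam l) :
    leg L lam i j = L - i := by
  unfold leg
  rw [Finset.filter_true_of_mem]
  · simp
  · intro l hl
    rw [Finset.mem_Icc] at hl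
    exact h l (by omega) hl.2

/-- The contribution of the boxes of row `i` in columns beyond `m`, when only the rows
`i, …, i + d` are taken into account and `m` is at most the length of the last of them. -/
theorem prod_qPoch_row {R : Type*} [CommRing R] (q t : R) (i : ℕ) (lam : ℕ → ℕ) (d : ℕ)
    (hlam : ∀ j k, i ≤ j → j ≤ k → k ≤ i + d → lam k ≤ lam j) (m : ℕ) (hm : m ≤ lam (i + d)) :
    (∏ j ∈ Finset.Ioc i (i + d), qPoch (q * t ^ (j - i)) q (lam i - lam j))
        * qPoch (q * t ^ (d + 1)) q (lam i - m)
      = (∏ j ∈ Finset.Ioc m (lam i), (1 - q * t * q ^ (lam i - j) * t ^ leg (i + d) lam i j))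
        * ∏ j ∈ Finset.Ioc i (i + d), qPoch (q * t ^ (j - i + 1)) q (lam i - lam j) := by
  induction d generalizing m with
  | zero => simp [qPoch_sub_eq_prod_Ioc, leg_self]
  | succ d ih =>
    rw [← add_assoc] at hm hlam ⊢
    have hki : lam (i + d + 1) ≤ lam i := hlam _ _ le_rfl (by omega) le_rfl
    have ih' := ih (fun j k h1 h2 h3 => hlam j k h1 h2 (by omega)) (lam (i + d + 1))
      (hlam _ _ (by omega) (by omega) le_rfl)
    have hfar : ∏ j ∈ Finset.Ioc (lam (i + d + 1)) (lam i),
          (1 - q * t * q ^ (lam i - j) * t ^ leg (i + d + 1) lam i j)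
        = ∏ j ∈ Finset.Ioc (lam (i + d + 1)) (lam i),
          (1 - q * t * q ^ (lam i - j) * t ^ leg (i + d) lam i j) := by
      refine Finset.prod_congr rfl fun j hj => ?_
      rw [leg_succ_of_lt (Finset.mem_Ioc.1 hj).1]
    have hnear : ∏ j ∈ Finset.Ioc m (lam (i + d + 1)),
          (1 - q * t * q ^ (lam i - j) * t ^ leg (i + d + 1) lam i j)
        = ∏ j ∈ Finset.Ioc m (lam (i + d + 1)),
          (1 - q * t ^ (d + 1 + 1) * q ^ (lam i - j)) := by
      refine Finset.prod_congr rfl fun j hj => ?_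
      rw [leg_eq_sub fun l h1 h2 =>
        (Finset.mem_Ioc.1 hj).2.trans (hlam l _ h1.le h2 le_rfl),
        show i + d + 1 - i = d + 1 by omega]
      ring
    have hpoch : qPoch (q * t ^ (d + 1 + 1)) q (lam i - m)
        = (∏ j ∈ Finset.Ioc m (lam (i + d + 1)), (1 - q * t ^ (d + 1 + 1) * q ^ (lam i - j)))
          * qPoch (q * t ^ (d + 1 + 1)) q (lam i - lam (i + d + 1)) := by
      rw [qPoch_sub_eq_prod_Ioc, qPoch_sub_eq_prod_Ioc, Finset.prod_Ioc_consecutive _ hm hki]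
    rw [Finset.prod_Ioc_succ_top (by omega), Finset.prod_Ioc_succ_top (by omega),
      show i + d + 1 - i = d + 1 by omega, ← Finset.prod_Ioc_consecutive _ hm hki, hfar, hnear,
      hpoch, ih']
    ring

theorem prod_filter_lt_Icc {R : Type*} [CommMonoid R] (L : ℕ) (f : ℕ × ℕ → R) :
    ∏ p ∈ (Finset.Icc 1 L ×ˢ Finset.Icc 1 L).filter (fun p => p.1 < p.2), f p
      = ∏ i ∈ Finset.Icc 1 L, ∏ j ∈ Finset.Ioc i L, f (i, j) := by
  refine Finset.prod_finset_product _ _ _ fun p => ?_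
  simp only [Finset.mem_filter, Finset.mem_product, Finset.mem_Icc, Finset.mem_Ioc]
  omega

/-- In `ℤ[q,t]`:
`∏_{1≤i<j≤L} (qt^{j−i};q)_{λ_i−λ_j} · ∏_{i=1}^{L} (qt^{L−i+1};q)_{λ_i}
  = h_{q,t}(qt;λ) · ∏_{1≤i<j≤L} (qt^{j−i+1};q)_{λ_i−λ_j}`. -/
theorem hook_product_identity (L : ℕ) (hL : 1 ≤ L) (lam : ℕ → ℕ)
    (hpart : ∀ i j : ℕ, 1 ≤ i → i ≤ j → j ≤ L → lam j ≤ lam i) :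
    (∏ p ∈ (Finset.Icc 1 L ×ˢ Finset.Icc 1 L).filter (fun p => p.1 < p.2),
        qPoch ((MvPolynomial.X 0 : MvPolynomial (Fin 2) ℤ) *
            (MvPolynomial.X 1) ^ (p.2 - p.1)) (MvPolynomial.X 0)
          (lam p.1 - lam p.2))
      * (∏ i ∈ Finset.Icc 1 L,
          qPoch ((MvPolynomial.X 0 : MvPolynomial (Fin 2) ℤ) *
              (MvPolynomial.X 1) ^ (L - i + 1)) (MvPolynomial.X 0) (lam i))
    = hookProd L lam
        ((MvPolynomial.X 0 : MvPolynomial (Fin 2) ℤ) * MvPolynomial.X 1)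
        (MvPolynomial.X 0) (MvPolynomial.X 1)
      * (∏ p ∈ (Finset.Icc 1 L ×ˢ Finset.Icc 1 L).filter (fun p => p.1 < p.2),
          qPoch ((MvPolynomial.X 0 : MvPolynomial (Fin 2) ℤ) *
              (MvPolynomial.X 1) ^ (p.2 - p.1 + 1)) (MvPolynomial.X 0)
            (lam p.1 - lam p.2)) := by
  rw [prod_filter_lt_Icc, prod_filter_lt_Icc, hookProd, ← Finset.prod_mul_distrib,
    ← Finset.prod_mul_distrib]
  refine Finset.prod_congr rfl fun i hi => ?_
  rw [Finset.mem_Icc] at hi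
  have h := prod_qPoch_row (MvPolynomial.X 0 : MvPolynomial (Fin 2) ℤ) (MvPolynomial.X 1) i lam
    (L - i) (fun j k h1 h2 h3 => hpart j k (by omega) h2 (by omega)) 0 (Nat.zero_le _)
  rwa [show i + (L - i) = L by omega, Nat.sub_zero] at h
end

section
/- The operators T_1, …, T_{N−1} on P satisfy the braid relations: T_i T_{i+1} T_i = T_{i+1} T_i T_{i+1} for 1 ≤ i ≤ N−2, and T_i T_j = T_j T_i whenever |i − j| ≥ 2. -/
open Finset

noncomputable def phi (K : Type*) [Field K] (E : Finset ℕ) : Finset ℕ →₀ K :=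
  Finsupp.single E 1

noncomputable def Tgen {K : Type*} [Field K] (t : K) (i : ℕ) :
    (Finset ℕ →₀ K) →ₗ[K] (Finset ℕ →₀ K) :=
  Finsupp.lift _ K _ fun E =>
    if i ∈ E then
      if i + 1 ∈ E then -(phi K E)
      else phi K (insert (i + 1) (E.erase i))
    else
      if i + 1 ∈ E then t • phi K (insert i (E.erase (i + 1))) + (t - 1) • phi K E
      else t • phi K E

def sgn (i : ℕ) (E : Finset ℕ) : ℕ := (E.filter (· < i)).card

noncomputable def Mop (K : Type*) [Field K] (N : ℕ) :
    (Finset ℕ →₀ K) →ₗ[K] (Finset ℕ →₀ K) :=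
  Finsupp.lift _ K _ fun E =>
    ∑ i ∈ (Finset.Icc 1 N) \ E, ((-1 : K) ^ sgn i E) • phi K (insert i E)

noncomputable def Dop {K : Type*} [Field K] (t : K) :
    (Finset ℕ →₀ K) →ₗ[K] (Finset ℕ →₀ K) :=
  Finsupp.lift _ K _ fun E =>
    ∑ i ∈ E, ((-1 : K) ^ sgn i E * t ^ (i - 1)) • phi K (E.erase i)

noncomputable def qint {K : Type*} [Field K] (t : K) (n : ℕ) : K :=
  ∑ i ∈ Finset.range n, t ^ i

noncomputable def kappa {K : Type*} [Field K] (t : K) (n : ℤ) : K :=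
  if 0 < n then t ^ n.toNat / qint t n.toNat else -(1 / qint t (-n).toNat)

theorem Tgen_phi {K : Type*} [Field K] (t : K) (i : ℕ) (E : Finset ℕ) :
    Tgen t i (phi K E) =
      if i ∈ E then
        if i + 1 ∈ E then -(phi K E)
        else phi K (insert (i + 1) (E.erase i))
      else
        if i + 1 ∈ E then t • phi K (insert i (E.erase (i + 1))) + (t - 1) • phi K E
        else t • phi K E := by
  simp only [Tgen, phi, Finsupp.lift_apply, Finsupp.sum_single_index, zero_smul, one_smul]

theorem linearMap_ext_phi {K : Type*} [Field K] {f g : (Finset ℕ →₀ K) →ₗ[K] (Finset ℕ →₀ K)}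
    (h : ∀ E, f (phi K E) = g (phi K E)) : f = g :=
  Finsupp.lhom_ext' fun E => LinearMap.ext_ring (h E)

theorem insert_erase_insert_erase_of_mem {a b c : ℕ} {E : Finset ℕ} (hb : b ∈ E) (hca : a ≠ c)
    (hcb : b ≠ c) : insert b ((insert a (E.erase b)).erase c) = insert a (E.erase c) := by
  grind

theorem insert_erase_insert_erase_comm {a b c d : ℕ} (E : Finset ℕ) (hac : a ≠ c) (hbd : b ≠ d) :
    insert a ((insert b (E.erase c)).erase d) = insert b ((insert a (E.erase d)).erase c) := by
  grind

theorem Tgen_braid {K : Type*} [Field K] (t : K) (i : ℕ) :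
    (Tgen t i) ∘ₗ (Tgen t (i + 1)) ∘ₗ (Tgen t i)
      = (Tgen t (i + 1)) ∘ₗ (Tgen t i) ∘ₗ (Tgen t (i + 1)) := by
  refine linearMap_ext_phi fun E => ?_
  have a1 : i ≠ i + 1 + 1 := by omega
  by_cases h0 : i ∈ E <;> by_cases h1 : i + 1 ∈ E <;> by_cases h2 : i + 1 + 1 ∈ E <;>
    simp [Tgen_phi, h0, h1, h2, a1, a1.symm, insert_erase_insert_erase_of_mem]
  all_goals module

theorem Tgen_comm {K : Type*} [Field K] (t : K) {i j : ℕ} (h : i + 2 ≤ j) :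
    (Tgen t i) ∘ₗ (Tgen (K := K) t j) = (Tgen t j) ∘ₗ (Tgen t i) := by
  refine linearMap_ext_phi fun E => ?_
  have a1 : i ≠ j := by omega
  have a2 : i + 1 ≠ j := by omega
  have a3 : i ≠ j + 1 := by omega
  by_cases h0 : i ∈ E <;> by_cases h1 : i + 1 ∈ E <;> by_cases h2 : j ∈ E <;>
    by_cases h3 : j + 1 ∈ E <;>
    simp [Tgen_phi, h0, h1, h2, h3, a1, a2, a3, a1.symm, a2.symm, a3.symm,
      insert_erase_insert_erase_comm (a := i) E, insert_erase_insert_erase_comm (a := i + 1) E]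
  all_goals module

/-- The Hecke algebra generators `T_i` (1 ≤ i ≤ N−1) on the space of fermionic
polynomials satisfy the braid relations. -/
theorem braid_relations {K : Type*} [Field K] (t : K) (N : ℕ) (hN : 1 ≤ N) :
    (∀ i : ℕ, 1 ≤ i → i ≤ N - 2 →
      (Tgen t i) ∘ₗ (Tgen t (i + 1)) ∘ₗ (Tgen t i)
        = (Tgen t (i + 1)) ∘ₗ (Tgen t i) ∘ₗ (Tgen t (i + 1))) ∧
    (∀ i j : ℕ, 1 ≤ i → i ≤ N - 1 → 1 ≤ j → j ≤ N - 1 → (i + 2 ≤ j ∨ j + 2 ≤ i) →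
      (Tgen t i) ∘ₗ (Tgen (K := K) t j) = (Tgen t j) ∘ₗ (Tgen t i)) := by
  refine ⟨fun i _ _ => Tgen_braid t i, fun i j _ _ _ _ h => ?_⟩
  rcases h with h | h
  · exact Tgen_comm t h
  · exact (Tgen_comm t h).symm
end

section
/- Each operator T_i (1 ≤ i ≤ N−1) on P satisfies the quadratic relation (T_i − t)(T_i + 1) = 0, i.e. T_i² = (t−1) T_i + t · id_P. -/
open Finset

theorem insert_erase_insert_erase {E : Finset ℕ} {a b : ℕ} (ha : a ∈ E) (hb : b ∉ E) :
    insert a ((insert b (E.erase a)).erase b) = E := by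
  rw [erase_insert (fun h => hb (mem_of_mem_erase h)), insert_erase ha]

/-- Each generator `T_i` (1 ≤ i ≤ N−1) satisfies the Hecke quadratic relation
`(T_i − t)(T_i + 1) = 0`, i.e. `T_i² = (t−1)·T_i + t·id`. -/
theorem quadratic_relation {K : Type*} [Field K] (t : K) (N : ℕ) (hN : 1 ≤ N)
    (i : ℕ) (hi1 : 1 ≤ i) (hiN : i ≤ N - 1) :
    (Tgen t i) ∘ₗ (Tgen t i)
      = (t - 1) • (Tgen t i) + t • (LinearMap.id : (Finset ℕ →₀ K) →ₗ[K] (Finset ℕ →₀ K)) := by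
  refine Finsupp.lhom_ext' fun E => LinearMap.ext_ring ?_
  change Tgen t i (Tgen t i (phi K E)) = (t - 1) • Tgen t i (phi K E) + t • phi K E
  by_cases h : i ∈ E <;> by_cases h' : i + 1 ∈ E
  · simp only [Tgen_phi, h, h', if_true, map_neg]
    module
  · have hT : Tgen t i (phi K E) = phi K (insert (i + 1) (E.erase i)) := by
      simp [Tgen_phi, h, h']
    rw [hT, Tgen_phi, if_neg (by simp), if_pos (by simp), insert_erase_insert_erase h h']
    module
  · have hT : Tgen t i (phi K E)
        = t • phi K (insert i (E.erase (i + 1))) + (t - 1) • phi K E := by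
      simp [Tgen_phi, h, h']
    have hT' : Tgen t i (phi K (insert i (E.erase (i + 1)))) = phi K E := by
      rw [Tgen_phi, if_pos (by simp), if_neg (by simp), insert_erase_insert_erase h' h]
    conv_lhs => rw [hT, map_add, map_smul, map_smul, hT']
    module
  · simp only [Tgen_phi, h, h', if_false, map_smul]
    module
end

section
/- The operators M and D on P satisfy the anticommutation identity M∘D + D∘M = [N]_t · id_P, where [N]_t = 1 + t + ⋯ + t^{N−1}. -/
open Finset

theorem sgn_insert {i j : ℕ} {E : Finset ℕ} (hj : j ∉ E) :
    sgn i (insert j E) = sgn i E + if j < i then 1 else 0 := by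
  unfold sgn
  rw [filter_insert]
  split_ifs
  · rw [card_insert_of_notMem (by simp [hj])]
  · rfl

theorem sgn_erase {i j : ℕ} {E : Finset ℕ} (hj : j ∈ E) :
    sgn i E = sgn i (E.erase j) + if j < i then 1 else 0 := by
  rw [← sgn_insert (notMem_erase j E), insert_erase hj]

theorem sgn_erase_self (i : ℕ) (E : Finset ℕ) : sgn i (E.erase i) = sgn i E := by
  by_cases hi : i ∈ E
  · simp [sgn_erase (i := i) hi]
  · rw [erase_eq_of_notMem hi]

theorem sgn_insert_self (i : ℕ) (E : Finset ℕ) : sgn i (insert i E) = sgn i E := by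
  by_cases hi : i ∈ E
  · rw [insert_eq_of_mem hi]
  · simp [sgn_insert hi]

theorem Mop_phi (K : Type*) [Field K] (N : ℕ) (E : Finset ℕ) :
    Mop K N (phi K E) = ∑ i ∈ Icc 1 N \ E, ((-1 : K) ^ sgn i E) • phi K (insert i E) := by
  simp [Mop, phi]

theorem Dop_phi {K : Type*} [Field K] (t : K) (E : Finset ℕ) :
    Dop t (phi K E) = ∑ i ∈ E, ((-1 : K) ^ sgn i E * t ^ (i - 1)) • phi K (E.erase i) := by
  simp [Dop, phi]

theorem sum_sdiff_erase {A : Type*} [AddCommMonoid A] {i : ℕ} {S E : Finset ℕ} (hi : i ∈ E)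
    (f : ℕ → A) :
    ∑ j ∈ S \ E.erase i, f j = (if i ∈ S then f i else 0) + ∑ j ∈ S \ E, f j := by
  split_ifs with h
  · rw [sdiff_erase h, sum_insert (by simp [hi])]
  · rw [zero_add]
    congr 1
    grind

/-- Creating at `j ∉ E` and annihilating at `i ∈ E` anticommute. -/
theorem neg_one_pow_sgn_swap {K : Type*} [Field K] {i j : ℕ} {E : Finset ℕ}
    (hi : i ∈ E) (hj : j ∉ E) :
    (-1 : K) ^ sgn i E * (-1) ^ sgn j (E.erase i) +
      (-1) ^ sgn j E * (-1) ^ sgn i (insert j E) = 0 := by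
  rw [sgn_insert hj, sgn_erase (i := j) hi]
  rcases (ne_of_mem_of_not_mem hi hj).lt_or_gt with h | h
  all_goals
    simp only [h, h.not_gt, if_true, if_false]
    ring

theorem neg_one_pow_mul_self {K : Type*} [Field K] (n : ℕ) : (-1 : K) ^ n * (-1) ^ n = 1 := by
  rw [← mul_pow]
  simp

theorem Mop_Dop_phi {K : Type*} [Field K] (t : K) (N : ℕ) (E : Finset ℕ) :
    Mop K N (Dop t (phi K E)) =
      (∑ i ∈ Icc 1 N ∩ E, t ^ (i - 1)) • phi K E +
        ∑ i ∈ E, ∑ j ∈ Icc 1 N \ E,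
          ((-1 : K) ^ sgn i E * (-1) ^ sgn j (E.erase i) * t ^ (i - 1)) •
            phi K (insert j (E.erase i)) := by
  rw [Dop_phi, map_sum, sum_smul, inter_comm, ← filter_mem_eq_inter, sum_filter,
    ← sum_add_distrib]
  refine sum_congr rfl fun i hi => ?_
  rw [map_smul, Mop_phi, sum_sdiff_erase hi, smul_add, smul_sum]
  congr 1
  · split_ifs
    · rw [smul_smul, sgn_erase_self, insert_erase hi, mul_right_comm, neg_one_pow_mul_self,
        one_mul]
    · rw [smul_zero]
  · refine sum_congr rfl fun j _ => ?_
    rw [smul_smul, mul_right_comm]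

theorem Dop_Mop_phi {K : Type*} [Field K] (t : K) (N : ℕ) (E : Finset ℕ) :
    Dop t (Mop K N (phi K E)) =
      (∑ i ∈ Icc 1 N \ E, t ^ (i - 1)) • phi K E +
        ∑ i ∈ E, ∑ j ∈ Icc 1 N \ E,
          ((-1 : K) ^ sgn j E * (-1) ^ sgn i (insert j E) * t ^ (i - 1)) •
            phi K (insert j (E.erase i)) := by
  rw [Mop_phi, map_sum, sum_smul, sum_comm, ← sum_add_distrib]
  refine sum_congr rfl fun j hj => ?_
  have hj := (mem_sdiff.mp hj).2
  rw [map_smul, Dop_phi, sum_insert hj, smul_add, smul_sum]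
  congr 1
  · rw [smul_smul, sgn_insert_self, erase_insert hj, ← mul_assoc, neg_one_pow_mul_self, one_mul]
  · refine sum_congr rfl fun i hi => ?_
    rw [smul_smul, erase_insert_of_ne (ne_of_mem_of_not_mem hi hj).symm, mul_assoc]

/-- The anticommutator identity `M∘D + D∘M = [N]_t · id`, where
`[N]_t = 1 + t + ⋯ + t^{N-1}`. -/
theorem MD_plus_DM {K : Type*} [Field K] (t : K) (N : ℕ) (hN : 1 ≤ N) :
    (Mop K N) ∘ₗ (Dop t) + (Dop t) ∘ₗ (Mop K N)
      = (∑ i ∈ Finset.range N, t ^ i) •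
          (LinearMap.id : (Finset ℕ →₀ K) →ₗ[K] (Finset ℕ →₀ K)) := by
  refine Finsupp.lhom_ext' fun E => LinearMap.ext_ring ?_
  change Mop K N (Dop t (phi K E)) + Dop t (Mop K N (phi K E)) =
    (∑ i ∈ range N, t ^ i) • phi K E
  rw [Mop_Dop_phi, Dop_Mop_phi, add_add_add_comm, ← add_smul, sum_inter_add_sum_sdiff,
    ← sum_add_distrib, sum_eq_zero (s := E), add_zero, range_eq_Ico,
    ← sum_Ico_add_right_sub_eq (c := 1)]
  · rfl
  · intro i hi
    rw [← sum_add_distrib]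
    refine sum_eq_zero fun j hj => ?_
    rw [← add_smul, ← add_mul, neg_one_pow_sgn_swap hi (mem_sdiff.mp hj).2, zero_mul, zero_smul]
end

section
/- Let K be a commutative ring, A an associative K-algebra with unit, t ∈ K, and S, U ∈ A satisfying the braid relation S U S = U S U and the quadratic relations S² = (t−1)S + t·1 and U² = (t−1)U + t·1. If a, b, c ∈ K satisfy b·(a + c + 1 − t) = a·c, then (S − a)(U − b)(S − c) = (U − c)(S − b)(U − a). -/
/-- The modified braid relation: if `S`, `U` satisfy the braid relation and the
Hecke quadratic relations with parameter `t`, and `b(a + c + 1 − t) = ac`, then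
`(S − a)(U − b)(S − c) = (U − c)(S − b)(U − a)`. -/
theorem modified_braid_relation {K : Type*} [CommRing K]
    {A : Type*} [Ring A] [Algebra K A] (t a b c : K) (S U : A)
    (hbraid : S * U * S = U * S * U)
    (hS : S ^ 2 = (t - 1) • S + t • (1 : A))
    (hU : U ^ 2 = (t - 1) • U + t • (1 : A))
    (hb : b * (a + c + 1 - t) = a * c) :
    (S - a • 1) * (U - b • 1) * (S - c • 1)
      = (U - c • 1) * (S - b • 1) * (U - a • 1) := by
  simp only [sub_mul, mul_sub, smul_mul_assoc, mul_smul_comm, one_mul, mul_one]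
  rw [pow_two] at hS hU
  linear_combination (norm := module) hbraid - b • hS + b • hU + hb • (S - U)
end

section
/- Let K be a field and t ∈ K such that [n]_t := 1 + t + ⋯ + t^{n−1} ≠ 0 for all n ≥ 1 occurring below. For n ≥ 1 set κ_n = t^n/[n]_t and κ_{−n} = −1/[n]_t. Let A be an associative K-algebra with unit, and S, U ∈ A satisfying S U S = U S U, S² = (t−1)S + t·1, and U² = (t−1)U + t·1. Then for any nonzero integers j, ℓ with j + ℓ ≠ 0, (S − κ_j)(U − κ_{j+ℓ})(S − κ_ℓ) = (U − κ_ℓ)(S − κ_{j+ℓ})(U − κ_j). -/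
theorem pow_eq_one_sub_mul_qint {K : Type*} [Field K] (t : K) (n : ℕ) :
    t ^ n = 1 - (1 - t) * qint t n := by
  rw [qint, mul_neg_geom_sum, sub_sub_cancel]

theorem qint_add {K : Type*} [Field K] (t : K) (m n : ℕ) :
    qint t (m + n) = qint t m + qint t n - (1 - t) * qint t m * qint t n := by
  have h : qint t (m + n) = qint t m + t ^ m * qint t n := by
    simp only [qint, Finset.sum_range_add, pow_add, Finset.mul_sum]
  rw [h, pow_eq_one_sub_mul_qint]
  ring

theorem kappa_natCast {K : Type*} [Field K] (t : K) {n : ℕ} (hn : 1 ≤ n) :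
    kappa t n = (1 - (1 - t) * qint t n) / qint t n := by
  have h : (0 : ℤ) < n := by omega
  rw [kappa, ← pow_eq_one_sub_mul_qint, if_pos h, Int.toNat_natCast]

theorem kappa_neg_natCast {K : Type*} [Field K] (t : K) (n : ℕ) :
    kappa t (-n) = -(1 / qint t n) := by
  have h : ¬ (0 : ℤ) < -n := by omega
  rw [kappa, if_neg h, neg_neg, Int.toNat_natCast]

theorem kappa_natCast_mul_neg_natCast {K : Type*} [Field K] (t : K)
    (hreg : ∀ n : ℕ, 1 ≤ n → qint t n ≠ 0) {m n : ℕ} (hm : 1 ≤ m) (hn : 1 ≤ n) (hmn : m ≠ n) :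
    kappa t m * kappa t (-n) =
      kappa t (m + -n) * (kappa t m + kappa t (-n) + 1 - t) := by
  rcases lt_or_gt_of_ne hmn with h | h
  · obtain ⟨k, rfl⟩ := Nat.exists_eq_add_of_lt h
    have hk : 1 ≤ k + 1 := by omega
    have hne := hreg _ hn
    have hsum : (m : ℤ) + -((m + k + 1 : ℕ) : ℤ) = -((k + 1 : ℕ) : ℤ) := by
      push_cast; ring
    rw [hsum, kappa_natCast t hm, kappa_neg_natCast, kappa_neg_natCast]
    rw [add_assoc, qint_add] at hne ⊢
    have hm0 := hreg _ hm
    have hk0 := hreg _ hk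
    field_simp
    ring
  · obtain ⟨k, rfl⟩ := Nat.exists_eq_add_of_lt h
    have hk : 1 ≤ k + 1 := by omega
    have hne := hreg _ hm
    have hsum : ((n + k + 1 : ℕ) : ℤ) + -(n : ℤ) = ((k + 1 : ℕ) : ℤ) := by
      push_cast; ring
    rw [hsum, kappa_natCast t hm, kappa_neg_natCast, kappa_natCast t hk]
    rw [add_assoc, qint_add] at hne ⊢
    have hn0 := hreg _ hn
    have hk0 := hreg _ hk
    field_simp
    ring

theorem kappa_mul_kappa {K : Type*} [Field K] (t : K)
    (hreg : ∀ n : ℕ, 1 ≤ n → qint t n ≠ 0)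
    (j l : ℤ) (hj : j ≠ 0) (hl : l ≠ 0) (hjl : j + l ≠ 0) :
    kappa t j * kappa t l = kappa t (j + l) * (kappa t j + kappa t l + 1 - t) := by
  obtain ⟨m, rfl | rfl⟩ := Int.eq_nat_or_neg j <;>
    obtain ⟨n, rfl | rfl⟩ := Int.eq_nat_or_neg l
  all_goals
    have hm : 1 ≤ m := by omega
    have hn : 1 ≤ n := by omega
    have hm0 := hreg m hm
    have hn0 := hreg n hn
    have hne := hreg (m + n) (by omega)
  · rw [← Nat.cast_add, kappa_natCast t hm, kappa_natCast t hn, kappa_natCast t (by omega)]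
    rw [qint_add] at hne ⊢
    field_simp
    ring
  · exact kappa_natCast_mul_neg_natCast t hreg hm hn (by omega)
  · rw [mul_comm, add_comm (-(m : ℤ)), add_comm (kappa t (-m))]
    exact kappa_natCast_mul_neg_natCast t hreg hn hm (by omega)
  · rw [← neg_add, ← Nat.cast_add, kappa_neg_natCast, kappa_neg_natCast, kappa_neg_natCast]
    field_simp
    rw [qint_add]
    ring

theorem sub_smul_mul_sub_smul_mul_sub_smul {K A : Type*} [Field K] [Ring A] [Algebra K A]
    {t a b c : K} (habc : a * b = c * (a + b + 1 - t)) {S : A} (U : A)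
    (hS : S ^ 2 = (t - 1) • S + t • (1 : A)) :
    (S - a • 1) * (U - c • 1) * (S - b • 1) =
      S * U * S - b • (S * U) - a • (U * S) + (a * b) • (S + U) - (c * t + a * b * c) • 1 := by
  have h : (S - a • 1) * (U - c • 1) * (S - b • 1) =
      S * U * S - c • S ^ 2 - b • (S * U) - a • (U * S) + (c * (a + b)) • S + (a * b) • U
        - (a * b * c) • 1 := by
    simp only [sub_mul, mul_sub, smul_mul_assoc, mul_smul_comm, one_mul, mul_one, sq]
    module
  rw [h, hS, smul_add (a * b) S U]
  nth_rewrite 3 [habc]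
  module

/-- The κ-version of the modified braid relation: for nonzero integers `j`, `ℓ`
with `j + ℓ ≠ 0`,
`(S − κ_j)(U − κ_{j+ℓ})(S − κ_ℓ) = (U − κ_ℓ)(S − κ_{j+ℓ})(U − κ_j)`. -/
theorem modified_braid_relation_kappa {K : Type*} [Field K] (t : K)
    (hreg : ∀ n : ℕ, 1 ≤ n → qint t n ≠ 0)
    {A : Type*} [Ring A] [Algebra K A] (S U : A)
    (hbraid : S * U * S = U * S * U)
    (hS : S ^ 2 = (t - 1) • S + t • (1 : A))
    (hU : U ^ 2 = (t - 1) • U + t • (1 : A))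
    (j l : ℤ) (hj : j ≠ 0) (hl : l ≠ 0) (hjl : j + l ≠ 0) :
    (S - kappa t j • 1) * (U - kappa t (j + l) • 1) * (S - kappa t l • 1)
      = (U - kappa t l • 1) * (S - kappa t (j + l) • 1) * (U - kappa t j • 1) := by
  have hk := kappa_mul_kappa t hreg j l hj hl hjl
  have hk' : kappa t l * kappa t j = kappa t (j + l) * (kappa t l + kappa t j + 1 - t) := by
    rw [mul_comm, hk, add_comm (kappa t j)]
  rw [sub_smul_mul_sub_smul_mul_sub_smul hk U hS, sub_smul_mul_sub_smul_mul_sub_smul hk' S hU,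
    hbraid]
  module
end

section
/- Let N ≥ 1, K a field, q, t ∈ K nonzero, and c : {1,…,N} → ℤ any function. For β ∈ ℕ^N define the rank function r_β by r_β(i) = #{j : β_j > β_i} + #{j ≤ i : β_j = β_i}, and the spectral vector ζ_β(i) = q^{β_i} t^{c(r_β(i))}. For any function u : K → K set R_u(β) = ∏_{1 ≤ i < j ≤ N, β_i < β_j} u(ζ_β(j)/ζ_β(i)). If β_i < β_{i+1} for some 1 ≤ i ≤ N−1, then R_u(β) = u(ζ_β(i+1)/ζ_β(i)) · R_u(s_i β), where s_i β is β with entries i and i+1 interchanged. -/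
/-- The rank function `r_β(i) = #{j : β_j > β_i} + #{j ≤ i : β_j = β_i}`
(with `j` ranging over `{1,…,N}`). -/
def rankFn (N : ℕ) (β : ℕ → ℕ) (i : ℕ) : ℕ :=
  ((Finset.Icc 1 N).filter fun j => β i < β j).card
    + ((Finset.Icc 1 i).filter fun j => β j = β i).card

/-- The spectral vector `ζ_β(i) = q^{β_i} t^{c(r_β(i))}`. -/
noncomputable def zeta {K : Type*} [Field K] (N : ℕ) (q t : K) (c : ℕ → ℤ)
    (β : ℕ → ℕ) (i : ℕ) : K :=
  q ^ β i * t ^ c (rankFn N β i)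

/-- `R_u(β) = ∏_{1 ≤ i < j ≤ N, β_i < β_j} u(ζ_β(j)/ζ_β(i))`. -/
noncomputable def Ru {K : Type*} [Field K] (N : ℕ) (q t : K) (c : ℕ → ℤ)
    (u : K → K) (β : ℕ → ℕ) : K :=
  ∏ p ∈ (Finset.Icc 1 N ×ˢ Finset.Icc 1 N).filter
      (fun p => p.1 < p.2 ∧ β p.1 < β p.2),
    u (zeta N q t c β p.2 / zeta N q t c β p.1)

/-- `β` with entries `i` and `i+1` interchanged. -/
def swapEntries (β : ℕ → ℕ) (i : ℕ) : ℕ → ℕ :=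
  fun j => if j = i then β (i + 1) else if j = i + 1 then β i else β j

theorem swapEntries_eq_comp_swap (β : ℕ → ℕ) (i j : ℕ) :
    swapEntries β i j = β (Equiv.swap i (i + 1) j) := by
  simp only [swapEntries, Equiv.swap_apply_def]
  split_ifs <;> rfl

theorem swap_succ_mem_Icc {N i : ℕ} (hi1 : 1 ≤ i) (hiN : i + 1 ≤ N) {j : ℕ} :
    Equiv.swap i (i + 1) j ∈ Finset.Icc 1 N ↔ j ∈ Finset.Icc 1 N := by
  simp only [Equiv.swap_apply_def, Finset.mem_Icc]
  split_ifs <;> omega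

theorem rankFn_swapEntries {N i : ℕ} {β : ℕ → ℕ} (hi1 : 1 ≤ i) (hiN : i + 1 ≤ N)
    (hβ : β i ≠ β (i + 1)) (j : ℕ) :
    rankFn N (swapEntries β i) j = rankFn N β (Equiv.swap i (i + 1) j) := by
  unfold rankFn
  simp only [swapEntries_eq_comp_swap]
  congr 1
  · refine Finset.card_equiv (Equiv.swap i (i + 1)) fun k => ?_
    simp only [Finset.mem_filter, swap_succ_mem_Icc hi1 hiN]
  · refine Finset.card_equiv (Equiv.swap i (i + 1)) fun k => ?_
    simp only [Equiv.swap_apply_def]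
    grind

theorem zeta_swapEntries {K : Type*} [Field K] {N i : ℕ} (q t : K) (c : ℕ → ℤ)
    {β : ℕ → ℕ} (hi1 : 1 ≤ i) (hiN : i + 1 ≤ N) (hβ : β i ≠ β (i + 1)) (j : ℕ) :
    zeta N q t c (swapEntries β i) j = zeta N q t c β (Equiv.swap i (i + 1) j) := by
  rw [zeta, zeta, rankFn_swapEntries hi1 hiN hβ, swapEntries_eq_comp_swap]

/-- If `β_i < β_{i+1}` then `R_u(β) = u(ζ_β(i+1)/ζ_β(i)) · R_u(s_i β)`. -/
theorem Ru_step {K : Type*} [Field K] (N : ℕ) (hN : 1 ≤ N) (q t : K)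
    (hq : q ≠ 0) (ht : t ≠ 0) (c : ℕ → ℤ) (u : K → K) (β : ℕ → ℕ)
    (i : ℕ) (hi1 : 1 ≤ i) (hiN : i + 1 ≤ N) (hβ : β i < β (i + 1)) :
    Ru N q t c u β
      = u (zeta N q t c β (i + 1) / zeta N q t c β i)
          * Ru N q t c u (swapEntries β i) := by
  have hmem : (i, i + 1) ∈ (Finset.Icc 1 N ×ˢ Finset.Icc 1 N).filter
      (fun p => p.1 < p.2 ∧ β p.1 < β p.2) := by
    simp only [Finset.mem_filter, Finset.mem_product, Finset.mem_Icc]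
    omega
  unfold Ru
  rw [← Finset.mul_prod_erase _ _ hmem]
  congr 1
  refine Finset.prod_equiv
    ((Equiv.swap i (i + 1)).prodCongr (Equiv.swap i (i + 1))) (fun p => ?_) (fun p _ => ?_)
  · obtain ⟨a, b⟩ := p
    simp only [Finset.mem_erase, Finset.mem_filter, Finset.mem_product, Equiv.prodCongr_apply,
      Prod.map_apply, swap_succ_mem_Icc hi1 hiN, swapEntries_eq_comp_swap,
      Equiv.swap_apply_self, ne_eq, Prod.mk.injEq]
    simp only [Equiv.swap_apply_def]
    grind
  · simp [zeta_swapEntries q t c hi1 hiN hβ.ne]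
end

section
/- Let 1 ≤ m ≤ N−1 and assume [n]_t ≠ 0 for 1 ≤ n ≤ N−m. Then for every 1 ≤ i ≤ N−m, (T_{N−i} − κ_{m−N+i−1})(T_{N−i+1} − κ_{m−N+i−2})⋯(T_{N−1} − κ_{m−N}) φ_{{1,…,m−1}∪{N}} = t^{i} φ_{{1,…,m−1}∪{N−i}} + (t^{N−m}/[N−m+1−i]_t) · Σ_{j=0}^{i−1} φ_{{1,…,m−1}∪{N−j}}, where the operator product is composed so that the rightmost factor (T_{N−1} − κ_{m−N}) acts first. In particular, for i = N−m the left side equals t^{N−m} · Σ_{j=m}^{N} φ_{{1,…,m−1}∪{j}}. -/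
open Finset

section QuantumIntegers

variable {K : Type*} [Field K] (t : K)

theorem qint_succ_eq_mul_add_one (k : ℕ) : qint t (k + 1) = t * qint t k + 1 := by
  simp [qint, Finset.sum_range_succ', Finset.mul_sum, pow_succ']

theorem sub_one_mul_qint (k : ℕ) : (t - 1) * qint t k = t ^ k - 1 :=
  mul_geom_sum t k

theorem kappa_of_neg (k : ℕ) (z : ℤ) (hz : z = -(k : ℤ)) : kappa t z = -(1 / qint t k) := by
  subst hz
  simp [kappa]

theorem Tgen_phi_of_notMem_of_mem {i : ℕ} {A : Finset ℕ} (hi : i ∉ A) (hi' : i + 1 ∉ A) :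
    Tgen t i (phi K (insert (i + 1) A))
      = t • phi K (insert i A) + (t - 1) • phi K (insert (i + 1) A) := by
  rw [Tgen, phi, Finsupp.lift_apply, Finsupp.sum_single_index (by rw [zero_smul]), one_smul]
  simp [phi, hi, hi']

theorem Tgen_phi_of_notMem_of_notMem {i : ℕ} {E : Finset ℕ} (hi : i ∉ E) (hi' : i + 1 ∉ E) :
    Tgen t i (phi K E) = t • phi K E := by
  rw [Tgen, phi, Finsupp.lift_apply, Finsupp.sum_single_index (by rw [zero_smul]), one_smul]
  simp [phi, hi, hi']

end QuantumIntegers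

theorem prod_Tgen_sub_kappa_apply {K : Type*} [Field K] (t : K) (N m : ℕ)
    (hm1 : 1 ≤ m) (hreg : ∀ n : ℕ, 1 ≤ n → n ≤ N - m → qint t n ≠ 0) (i : ℕ) (hi : i ≤ N - m) :
    (((List.range i).map fun l =>
        (Tgen t (N - i + l) : Module.End K (Finset ℕ →₀ K))
          - kappa t ((m : ℤ) - N + i - 1 - l) • 1).prod)
      (phi K (insert N (Finset.Icc 1 (m - 1))))
    = (t ^ i) • phi K (insert (N - i) (Finset.Icc 1 (m - 1)))
      + (t ^ (N - m) / qint t (N - m + 1 - i)) •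
          ∑ j ∈ Finset.range i, phi K (insert (N - j) (Finset.Icc 1 (m - 1))) := by
  induction i with
  | zero => simp
  | succ i ih =>
    have ih := ih (by omega)
    obtain ⟨k, hk⟩ : ∃ k, N = m + i + (k + 1) := ⟨N - m - i - 1, by omega⟩
    have hlist : (List.range i).map (fun l =>
          (Tgen t (N - (i + 1) + (l + 1)) : Module.End K (Finset ℕ →₀ K))
            - kappa t ((m : ℤ) - N + (i + 1 : ℕ) - 1 - (l + 1 : ℕ)) • 1)
        = (List.range i).map (fun l =>
          (Tgen t (N - i + l) : Module.End K (Finset ℕ →₀ K))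
            - kappa t ((m : ℤ) - N + i - 1 - l) • 1) := by
      refine List.map_congr_left fun l _ => ?_
      congr 2
      · omega
      · congr 1
        push_cast
        ring
    rw [List.range_succ_eq_map, List.map_cons, List.map_map, List.prod_cons, Module.End.mul_apply]
    simp only [Function.comp_def, Nat.succ_eq_add_one]
    rw [hlist, ih, kappa_of_neg t (k + 1) _ (by push_cast [hk]; ring)]
    have hq : qint t (k + 1) ≠ 0 := hreg _ (by omega) (by omega)
    have e1 : N - (i + 1) + 0 = m + k := by omega
    have e2 : N - (i + 1) = m + k := by omega
    have e3 : N - i = m + k + 1 := by omega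
    have e4 : N - m + 1 - i = k + 1 + 1 := by omega
    have e5 : N - m + 1 - (i + 1) = k + 1 := by omega
    have e6 : N - m = i + (k + 1) := by omega
    have hT := Tgen_phi_of_notMem_of_mem (K := K) t (i := m + k) (A := Finset.Icc 1 (m - 1))
      (by simp; omega) (by simp; omega)
    have hS : Tgen t (m + k) (∑ j ∈ Finset.range i, phi K (insert (N - j) (Finset.Icc 1 (m - 1))))
        = t • ∑ j ∈ Finset.range i, phi K (insert (N - j) (Finset.Icc 1 (m - 1))) := by
      rw [map_sum, Finset.smul_sum]
      refine Finset.sum_congr rfl fun j hj => Tgen_phi_of_notMem_of_notMem t ?_ ?_ <;>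
      · rw [Finset.mem_range] at hj
        simp only [Finset.mem_insert, Finset.mem_Icc]
        omega
    rw [Finset.sum_range_succ, e1, e2, e3, e4, e5, e6]
    have hS0 : i = 0 → ∑ j ∈ Finset.range i, phi K (insert (N - j) (Finset.Icc 1 (m - 1))) = 0 := by
      rintro rfl
      simp
    generalize (∑ j ∈ Finset.range i, phi K (insert (N - j) (Finset.Icc 1 (m - 1)))) = S at *
    have hcoef : t - 1 + 1 / qint t (k + 1) = t ^ (k + 1) / qint t (k + 1) := by
      field_simp
      rw [sub_one_mul_qint]
      ring
    have hScoef : i ≠ 0 → t ^ (i + (k + 1)) / qint t (k + 1 + 1) * (t + 1 / qint t (k + 1))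
        = t ^ (i + (k + 1)) / qint t (k + 1) := by
      intro h
      have hq' : qint t (k + 1 + 1) ≠ 0 := hreg _ (by omega) (by omega)
      have : t + 1 / qint t (k + 1) = qint t (k + 1 + 1) / qint t (k + 1) := by
        rw [qint_succ_eq_mul_add_one t (k + 1)]
        field_simp
      rw [this]
      field_simp
    have hSsmul : (t ^ (i + (k + 1)) / qint t (k + 1 + 1) * (t + 1 / qint t (k + 1))) • S
        = (t ^ (i + (k + 1)) / qint t (k + 1)) • S := by
      rcases eq_or_ne i 0 with h | h
      · simp [hS0 h]
      · rw [hScoef h]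
    rw [LinearMap.sub_apply, LinearMap.smul_apply, Module.End.one_apply, map_add, map_smul,
      map_smul, hT, hS, smul_add _ S, ← hSsmul]
    have hphi : t ^ (i + (k + 1)) / qint t (k + 1) = t ^ i * (t - 1 + 1 / qint t (k + 1)) := by
      rw [hcoef, pow_add, mul_div_assoc]
    rw [hphi]
    module

/-- For `1 ≤ i ≤ N−m`, the product
`(T_{N−i} − κ_{m−N+i−1})(T_{N−i+1} − κ_{m−N+i−2})⋯(T_{N−1} − κ_{m−N})`
(rightmost factor acting first) sends `φ_{{1,…,m−1}∪{N}}` to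
`t^i φ_{{1,…,m−1}∪{N−i}} + (t^{N−m}/[N−m+1−i]_t)·Σ_{j=0}^{i−1} φ_{{1,…,m−1}∪{N−j}}`;
in particular for `i = N−m` it gives `t^{N−m}·Σ_{j=m}^{N} φ_{{1,…,m−1}∪{j}}`. -/
theorem type1_partial_product_formula {K : Type*} [Field K] (t : K) (N m : ℕ)
    (hm1 : 1 ≤ m) (hmN : m ≤ N - 1)
    (hreg : ∀ n : ℕ, 1 ≤ n → n ≤ N - m → qint t n ≠ 0) :
    (∀ i : ℕ, 1 ≤ i → i ≤ N - m →
      (((List.range i).map fun l =>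
          (Tgen t (N - i + l) : Module.End K (Finset ℕ →₀ K))
            - kappa t ((m : ℤ) - N + i - 1 - l) • 1).prod)
        (phi K (insert N (Finset.Icc 1 (m - 1))))
      = (t ^ i) • phi K (insert (N - i) (Finset.Icc 1 (m - 1)))
        + (t ^ (N - m) / qint t (N - m + 1 - i)) •
            ∑ j ∈ Finset.range i, phi K (insert (N - j) (Finset.Icc 1 (m - 1)))) ∧
    ((((List.range (N - m)).map fun l =>
        (Tgen t (m + l) : Module.End K (Finset ℕ →₀ K))
          - kappa t (-1 - (l : ℤ)) • 1).prod)
        (phi K (insert N (Finset.Icc 1 (m - 1))))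
      = (t ^ (N - m)) •
          ∑ j ∈ Finset.Icc m N, phi K (insert j (Finset.Icc 1 (m - 1)))) := by
  refine ⟨fun i _ hi => prod_Tgen_sub_kappa_apply t N m hm1 hreg i hi, ?_⟩
  have h := prod_Tgen_sub_kappa_apply t N m hm1 hreg (N - m) le_rfl
  have e1 : N - (N - m) = m := by omega
  have e2 : N - m + 1 - (N - m) = 1 := by omega
  have e3 : ∀ l : ℕ, (m : ℤ) - N + (N - m : ℕ) - 1 - l = -1 - l := fun l => by omega
  simp only [e1, e2, e3] at h
  rw [h]
  have hq : qint t 1 = 1 := by simp [qint]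
  have hsum : ∑ j ∈ Finset.Icc m N, phi K (insert j (Finset.Icc 1 (m - 1)))
      = ∑ j ∈ Finset.range (N - m + 1), phi K (insert (N - j) (Finset.Icc 1 (m - 1))) := by
    refine Finset.sum_bij' (fun j _ => N - j) (fun j _ => N - j) ?_ ?_ ?_ ?_ ?_ <;>
      intro j hj <;> simp only [Finset.mem_range, Finset.mem_Icc] at hj ⊢
    any_goals omega
    congr 2
    omega
  rw [hq, div_one, hsum, Finset.sum_range_succ, e1, smul_add, add_comm]
end
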